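/- (Kernel smoothing lemma) Let K : ℝ → ℝ be a continuous nonnegative function supported in [−1,1], with second and third absolute moments μ₂(K) = ∫_{−1}^{1} |u|² K(u) du and μ₃(K) = ∫_{−1}^{1} |u|³ K(u) du, and for h ∈ (0,1] let K_h(u) = (1/h)K(u/h). Let g : [0,1] → ℝ be continuous. Then for all h ∈ (0,1]: | ∫₀¹ ∫₀¹ K_h(t−s) (t−s)² g((t+s)/2) ds dt − μ₂(K) h² ∫₀¹ g(v) dv | ≤ μ₃(K) (sup_{v∈[0,1]} |g(v)|) h³. In particular, ∫∫ K_h(t−s)(t−s)² g((t+s)/2) ds dt = μ₂(K) h² ∫₀¹ g + O(h³) as h → 0. -/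

import Mathlib

open Set intervalIntegral

open MeasureTheory in
/-- Change of variables `u = (t - s) / h`, `v = (t + s) / 2` on the unit square. -/
theorem integral_unitSquare_diff_mean {K g : ℝ → ℝ} (hK : Continuous K)
    (hKsupp : Function.support K ⊆ Icc (-1 : ℝ) 1) (hg : Continuous g) {h : ℝ}
    (h0 : 0 < h) (h1 : h ≤ 1) :
    (∫ t in (0 : ℝ)..1, ∫ s in (0 : ℝ)..1,
        (1 / h) * K ((t - s) / h) * (t - s) ^ 2 * g ((t + s) / 2)) =
      ∫ u in (-1 : ℝ)..1,
        h ^ 2 * u ^ 2 * K u * ∫ v in (|h * u| / 2)..(1 - |h * u| / 2), g v := by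
  set S : Set (ℝ × ℝ) := {p | p.1 ∈ Ioc (0 : ℝ) 1 ∧ p.1 - h * p.2 ∈ Ioc (0 : ℝ) 1} with hS
  set F : ℝ × ℝ → ℝ := fun p => h ^ 2 * p.2 ^ 2 * K p.2 * g (p.1 - h * p.2 / 2) with hF
  have hFc : Continuous F := by fun_prop
  have hSm : MeasurableSet S :=
    (measurable_fst measurableSet_Ioc).inter
      ((measurable_fst.sub (measurable_snd.const_mul h)) measurableSet_Ioc)
  have hSsub : S ⊆ Icc (0 : ℝ) 1 ×ˢ Icc (-(1 / h)) (1 / h) := by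
    rintro ⟨t, u⟩ ⟨⟨ht0, ht1⟩, hs0, hs1⟩
    simp only at ht0 ht1 hs0 hs1
    refine ⟨⟨ht0.le, ht1⟩, ?_, ?_⟩
    · rw [← neg_div, div_le_iff₀ h0]; simp only; nlinarith
    · rw [le_div_iff₀ h0]; simp only; nlinarith
  have hint : Integrable (S.indicator F) (volume.prod volume) := by
    rw [integrable_indicator_iff hSm]
    exact (hFc.continuousOn.integrableOn_compact
      (isCompact_Icc.prod isCompact_Icc)).mono_set hSsub
  have inner_s : ∀ t : ℝ, (Ioc (0 : ℝ) 1).indicator (fun t => ∫ s in (0 : ℝ)..1,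
        (1 / h) * K ((t - s) / h) * (t - s) ^ 2 * g ((t + s) / 2)) t =
      ∫ u, S.indicator F (t, u) := by
    intro t
    by_cases ht : t ∈ Ioc (0 : ℝ) 1
    · rw [indicator_of_mem ht, integral_of_le zero_le_one,
        ← MeasureTheory.integral_indicator measurableSet_Ioc,
        ← integral_sub_left_eq_self _ volume t]
      have := Measure.integral_comp_mul_left (fun x => (Ioc (0 : ℝ) 1).indicator (fun s =>
        (1 / h) * K ((t - s) / h) * (t - s) ^ 2 * g ((t + s) / 2)) (t - x)) h
      rw [abs_of_pos (inv_pos.2 h0), smul_eq_mul, eq_inv_mul_iff_mul_eq₀ h0.ne'] at this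
      rw [← this, ← MeasureTheory.integral_const_mul]
      congr 1 with u
      by_cases hu : t - h * u ∈ Ioc (0 : ℝ) 1
      · rw [indicator_of_mem hu, indicator_of_mem (show (t, u) ∈ S from ⟨ht, hu⟩)]
        have e1 : (t - (t - h * u)) / h = u := by field_simp; ring
        have e2 : (t + (t - h * u)) / 2 = t - h * u / 2 := by ring
        simp only [hF, e1, e2]
        field_simp
        ring
      · rw [indicator_of_notMem hu, indicator_of_notMem (fun hm : (t, u) ∈ S => hu hm.2),
          mul_zero]
    · rw [indicator_of_notMem ht]
      simp [indicator_of_notMem (fun hm : (t, _) ∈ S => ht hm.1)]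
  have inner_t : ∀ u : ℝ, (∫ t, S.indicator F (t, u)) =
      (Icc (-1 : ℝ) 1).indicator (fun u =>
        h ^ 2 * u ^ 2 * K u * ∫ v in (|h * u| / 2)..(1 - |h * u| / 2), g v) u := by
    intro u
    by_cases hu : u ∈ Icc (-1 : ℝ) 1
    · have hle : |h * u| ≤ 1 := by
        rw [abs_mul, abs_of_pos h0]
        exact mul_le_one₀ h1 (abs_nonneg u) (abs_le.2 hu)
      rw [indicator_of_mem hu, integral_of_le (by linarith), ← integral_Icc_eq_integral_Ioc,
        ← MeasureTheory.integral_const_mul, ← MeasureTheory.integral_indicator measurableSet_Icc,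
        ← integral_add_right_eq_self _ (h * u / 2)]
      apply MeasureTheory.integral_congr_ae
      have hne : ∀ᵐ v : ℝ, v ≠ |h * u| / 2 := by
        simp [ae_iff]
      filter_upwards [hne] with v hv
      have hmem : (v + h * u / 2, u) ∈ S ↔ v ∈ Icc (|h * u| / 2) (1 - |h * u| / 2) := by
        simp only [hS, mem_ofPred_eq, mem_Ioc, mem_Icc]
        rcases abs_cases (h * u) with ⟨e, _⟩ | ⟨e, _⟩ <;> rw [e] at hv ⊢ <;> constructor
        · rintro ⟨⟨_, _⟩, _, _⟩; constructor <;> linarith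
        · rintro ⟨hl, _⟩
          have := lt_of_le_of_ne hl hv.symm
          refine ⟨⟨?_, ?_⟩, ?_, ?_⟩ <;> linarith
        · rintro ⟨⟨_, _⟩, _, _⟩; constructor <;> linarith
        · rintro ⟨hl, _⟩
          have := lt_of_le_of_ne hl hv.symm
          refine ⟨⟨?_, ?_⟩, ?_, ?_⟩ <;> linarith
      by_cases hm : (v + h * u / 2, u) ∈ S
      · rw [indicator_of_mem hm, indicator_of_mem (hmem.1 hm)]
        simp [hF]
      · rw [indicator_of_notMem hm, indicator_of_notMem (mt hmem.2 hm)]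
    · have hK0 : K u = 0 := Function.notMem_support.1 (mt (@hKsupp u) hu)
      rw [indicator_of_notMem hu]
      simp [indicator_apply, hF, hK0]
  rw [integral_of_le zero_le_one, ← MeasureTheory.integral_indicator measurableSet_Ioc,
    integral_of_le (by norm_num), ← integral_Icc_eq_integral_Ioc,
    ← MeasureTheory.integral_indicator measurableSet_Icc]
  simp_rw [inner_s, ← inner_t]
  exact integral_integral_swap hint

/-- Trimming `δ / 2` from both ends of `[0, 1]` changes the integral by at most `M * δ`. -/
theorem abs_integral_trim_sub_le {g : ℝ → ℝ} (hg : Continuous g) {M : ℝ}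
    (hM : ∀ v, |g v| ≤ M) {δ : ℝ} (hδ : 0 ≤ δ) :
    |(∫ v in (δ / 2)..(1 - δ / 2), g v) - ∫ v in (0 : ℝ)..1, g v| ≤ M * δ := by
  have hi : ∀ a b : ℝ, IntervalIntegrable g MeasureTheory.volume a b :=
    fun a b => hg.intervalIntegrable a b
  have hb : ∀ a b : ℝ, ‖∫ v in a..b, g v‖ ≤ M * |b - a| := fun a b =>
    norm_integral_le_of_norm_le_const fun v _ => hM v
  have e1 := integral_add_adjacent_intervals (hi 0 (δ / 2)) (hi (δ / 2) (1 - δ / 2))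
  have e2 := integral_add_adjacent_intervals (hi 0 (1 - δ / 2)) (hi (1 - δ / 2) 1)
  have b1 := hb 0 (δ / 2)
  have b2 := hb (1 - δ / 2) 1
  rw [Real.norm_eq_abs, sub_zero, abs_of_nonneg (by linarith : 0 ≤ δ / 2), abs_le] at b1
  rw [Real.norm_eq_abs, sub_sub_cancel, abs_of_nonneg (by linarith : 0 ≤ δ / 2), abs_le] at b2
  rw [abs_le]
  constructor <;> linarith [b1.1, b1.2, b2.1, b2.2]

/-- The smoothing estimate for a weight bounded and continuous on the whole line. -/
theorem kernel_smoothing_of_continuous {K g : ℝ → ℝ} (hK : Continuous K) (hKpos : ∀ u, 0 ≤ K u)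
    (hKsupp : Function.support K ⊆ Icc (-1 : ℝ) 1) (hg : Continuous g) {M : ℝ}
    (hM : ∀ v, |g v| ≤ M) {h : ℝ} (h0 : 0 < h) (h1 : h ≤ 1) :
    |(∫ t in (0 : ℝ)..1, ∫ s in (0 : ℝ)..1,
          (1 / h) * K ((t - s) / h) * (t - s) ^ 2 * g ((t + s) / 2)) -
        (∫ u in (-1 : ℝ)..1, |u| ^ 2 * K u) * h ^ 2 * ∫ v in (0 : ℝ)..1, g v| ≤
      (∫ u in (-1 : ℝ)..1, |u| ^ 3 * K u) * M * h ^ 3 := by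
  have hcont : Continuous fun u => ∫ v in (|h * u| / 2)..(1 - |h * u| / 2), g v := by
    have hi : ∀ a b : ℝ, IntervalIntegrable g MeasureTheory.volume a b :=
      fun a b => hg.intervalIntegrable a b
    have hP : Continuous fun b => ∫ v in (0 : ℝ)..b, g v := continuous_primitive hi 0
    have hsub : ∀ u, (∫ v in (|h * u| / 2)..(1 - |h * u| / 2), g v) =
        (∫ v in (0 : ℝ)..(1 - |h * u| / 2), g v) - ∫ v in (0 : ℝ)..(|h * u| / 2), g v :=
      fun u => (integral_interval_sub_left (hi 0 _) (hi 0 _)).symm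
    exact ((hP.comp
      (by fun_prop : Continuous fun u => 1 - |h * u| / 2)).sub
      (hP.comp (by fun_prop : Continuous fun u => |h * u| / 2))).congr fun u => (hsub u).symm
  rw [integral_unitSquare_diff_mean hK hKsupp hg h0 h1, mul_assoc, mul_assoc,
    ← integral_mul_const, ← integral_mul_const, ← integral_sub, ← Real.norm_eq_abs]
  · refine norm_integral_le_of_norm_le (by norm_num)
      (MeasureTheory.ae_of_all _ fun u _ => ?_) (Continuous.intervalIntegrable (by fun_prop) _ _)
    have hnn : 0 ≤ h ^ 2 * u ^ 2 * K u := mul_nonneg (by positivity) (hKpos u)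
    calc _ = h ^ 2 * u ^ 2 * K u *
          |(∫ v in (|h * u| / 2)..(1 - |h * u| / 2), g v) - ∫ v in (0 : ℝ)..1, g v| := by
          rw [← abs_of_nonneg hnn, ← abs_mul, abs_of_nonneg hnn, Real.norm_eq_abs, sq_abs]
          congr 1
          ring
      _ ≤ h ^ 2 * u ^ 2 * K u * (M * |h * u|) :=
          mul_le_mul_of_nonneg_left (abs_integral_trim_sub_le hg hM (abs_nonneg _)) hnn
      _ = _ := by
          rw [abs_mul, abs_of_pos h0, ← sq_abs u]
          ring
  · exact Continuous.intervalIntegrable (by fun_prop) _ _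
  · exact Continuous.intervalIntegrable (by fun_prop) _ _

open Set intervalIntegral

/-- Kernel smoothing lemma: for a nonnegative continuous kernel `K` supported in
`[−1,1]`, with `K_h(u) = K(u/h)/h`, and any continuous `g` bounded by `Mg` on `[0,1]`,
`|∫₀¹∫₀¹ K_h(t−s)(t−s)² g((t+s)/2) ds dt − μ₂(K) h² ∫₀¹ g| ≤ μ₃(K) Mg h³`. -/
theorem kernel_smoothing_lemma
    (K : ℝ → ℝ) (hKcont : Continuous K) (hKpos : ∀ u, 0 ≤ K u)
    (hKsupp : Function.support K ⊆ Icc (-1 : ℝ) 1)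
    (μ₂ μ₃ : ℝ)
    (hμ₂ : μ₂ = ∫ u in (-1 : ℝ)..1, |u| ^ 2 * K u)
    (hμ₃ : μ₃ = ∫ u in (-1 : ℝ)..1, |u| ^ 3 * K u)
    (g : ℝ → ℝ) (hg : ContinuousOn g (Icc (0 : ℝ) 1))
    (Mg : ℝ) (hMg : ∀ v ∈ Icc (0 : ℝ) 1, |g v| ≤ Mg) :
    ∀ h ∈ Ioc (0 : ℝ) 1,
      |(∫ t in (0 : ℝ)..1, ∫ s in (0 : ℝ)..1,
            (1 / h) * K ((t - s) / h) * (t - s) ^ 2 * g ((t + s) / 2)) -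
          μ₂ * h ^ 2 * ∫ v in (0 : ℝ)..1, g v| ≤ μ₃ * Mg * h ^ 3 := by
  rintro h ⟨h0, h1⟩
  subst hμ₂ hμ₃
  set G : ℝ → ℝ := IccExtend (zero_le_one' ℝ) ((Icc (0 : ℝ) 1).domRestrict g)
  have hGc : Continuous G := hg.domRestrict.Icc_extend'
  have hGg : ∀ v ∈ Icc (0 : ℝ) 1, G v = g v := fun v hv => IccExtend_of_mem _ _ hv
  have key := kernel_smoothing_of_continuous hKcont hKpos hKsupp hGc
    (fun v => hMg _ (projIcc 0 1 (zero_le_one' ℝ) v).2) h0 h1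
  rw [← uIcc_of_le (zero_le_one' ℝ)] at hGg
  convert key using 3
  · refine integral_congr fun t ht => integral_congr fun s hs => ?_
    have hm : (t + s) / 2 ∈ uIcc (0 : ℝ) 1 := by
      rw [uIcc_of_le (zero_le_one' ℝ), mem_Icc] at *
      constructor <;> linarith [ht.1, ht.2, hs.1, hs.2]
    simp only [hGg _ hm]
  · rw [integral_congr hGg]
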